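/- For a generic endomorphism f of ℂⁿ (n ≥ 1): (a) if U is any open neighbourhood of a point of J_f, then the union ⋃_{k ≥ 0} f^[k](U) is dense in ℂⁿ; (b) for every attracting cycle A of f, J_f equals the topological boundary of the basin of attraction B(A). (Proposition 2.17 of the paper, proved for Oka-Stein manifolds; specialized to ℂⁿ.) -/

import Mathlib

open Function Topology Filter Metric

noncomputable section

/-- `ℂⁿ` as a Euclidean space. -/
abbrev Cn (n : ℕ) := EuclideanSpace ℂ (Fin n)

/-- The space `End(ℂⁿ)` of holomorphic self-maps of `ℂⁿ`, topologized as a subspace of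
the continuous maps `C(ℂⁿ, ℂⁿ)` with the compact-open topology. -/
abbrev Endo (n : ℕ) := {f : C(Cn n, Cn n) // Differentiable ℂ ⇑f}

variable {n : ℕ}

/-- The underlying function of an endomorphism. -/
def eapp (f : Endo n) : Cn n → Cn n := ⇑f.1

/-- `p` is a periodic point of `f`. -/
def IsPer (f : Endo n) (p : Cn n) : Prop := ∃ m, 1 ≤ m ∧ (eapp f)^[m] p = p

/-- The minimal period of a periodic point. -/
def minPer (f : Endo n) (p : Cn n) : ℕ := Function.minimalPeriod (eapp f) p

/-- The eigenvalues at a periodic point `p`: the spectrum of the derivative of the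
`minPer f p`-th iterate at `p`. -/
def eigs (f : Endo n) (p : Cn n) : Set ℂ := spectrum ℂ (fderiv ℂ ((eapp f)^[minPer f p]) p)

/-- Hyperbolic periodic point: no eigenvalue of absolute value 1. -/
def IsHypPer (f : Endo n) (p : Cn n) : Prop := IsPer f p ∧ ∀ z ∈ eigs f p, ‖z‖ ≠ 1

/-- Attracting periodic point: all eigenvalues of absolute value < 1. -/
def IsAttPer (f : Endo n) (p : Cn n) : Prop := IsPer f p ∧ ∀ z ∈ eigs f p, ‖z‖ < 1

/-- Repelling periodic point: all eigenvalues of absolute value > 1. -/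
def IsRepPer (f : Endo n) (p : Cn n) : Prop := IsPer f p ∧ ∀ z ∈ eigs f p, 1 < ‖z‖

/-- Saddle periodic point: hyperbolic with eigenvalues of absolute value both < 1 and > 1. -/
def IsSadPer (f : Endo n) (p : Cn n) : Prop :=
  IsHypPer f p ∧ (∃ z ∈ eigs f p, ‖z‖ < 1) ∧ (∃ z ∈ eigs f p, 1 < ‖z‖)

/-- Super-attracting periodic point: the derivative of the `minPer`-th iterate vanishes. -/
def IsSuperAttPer (f : Endo n) (p : Cn n) : Prop :=
  IsPer f p ∧ fderiv ℂ ((eapp f)^[minPer f p]) p = 0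

/-- The set of attracting periodic points of `f`. -/
def attSet (f : Endo n) : Set (Cn n) := {p | IsAttPer f p}

/-- The set of repelling periodic points of `f`. -/
def repSet (f : Endo n) : Set (Cn n) := {p | IsRepPer f p}

/-- The set of saddle periodic points of `f`. -/
def sadSet (f : Endo n) : Set (Cn n) := {p | IsSadPer f p}

/-- The robustly non-expelling set of `f`. -/
def rne (f : Endo n) : Set (Cn n) :=
  {p | ∃ U : Set (Cn n), IsOpen U ∧ p ∈ U ∧ ∃ V ∈ 𝓝 f, ∃ K : Set (Cn n),
        IsCompact K ∧ ∀ g ∈ V, ∀ j : ℕ, (eapp g)^[j] '' U ⊆ K}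

/-- A sequence of maps diverges locally uniformly to infinity on `U`. -/
def DivLocUnifOn (F : ℕ → Cn n → Cn n) (U : Set (Cn n)) : Prop :=
  ∀ L ⊆ U, IsCompact L → ∀ K : Set (Cn n), IsCompact K →
    ∀ᶠ j in atTop, Disjoint (F j '' L) K

/-- `p` belongs to the Fatou set of `f`: the iterates form a normal family near `p`. -/
def FatouAt (f : Endo n) (p : Cn n) : Prop :=
  ∃ U : Set (Cn n), IsOpen U ∧ p ∈ U ∧
    ∀ k : ℕ → ℕ, StrictMono k → ∃ l : ℕ → ℕ, StrictMono l ∧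
      ((∃ g : Cn n → Cn n, DifferentiableOn ℂ g U ∧
          TendstoLocallyUniformlyOn (fun j => (eapp f)^[k (l j)]) g atTop U) ∨
        DivLocUnifOn (fun j => (eapp f)^[k (l j)]) U)

/-- The Fatou set of `f`. -/
def Fatou (f : Endo n) : Set (Cn n) := {p | FatouAt f p}

/-- The Julia set of `f`. -/
def Julia (f : Endo n) : Set (Cn n) := (Fatou f)ᶜ

/-- The cycle (finite orbit) of a periodic point `p`. -/
def cycleOf (f : Endo n) (p : Cn n) : Set (Cn n) := {x | ∃ i < minPer f p, (eapp f)^[i] p = x}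

/-- The basin of attraction of the cycle of `p`. -/
def basinOf (f : Endo n) (p : Cn n) : Set (Cn n) :=
  {x | ∃ a ∈ cycleOf f p, Tendsto (fun k => (eapp f)^[minPer f p * k] x) atTop (𝓝 a)}

/-- The non-wandering set of `f`. -/
def nonWandering (f : Endo n) : Set (Cn n) :=
  {p | ∀ U ∈ 𝓝 p, ∃ k, 1 ≤ k ∧ (U ∩ (eapp f)^[k] '' U).Nonempty}

/-- The set of points whose orbit can be closed in the weak sense. -/
def cloSet (f : Endo n) : Set (Cn n) :=
  {p | ∀ U ∈ 𝓝 p, ∀ V ∈ 𝓝 f, ∃ g ∈ V, ∃ q ∈ U, IsPer g q}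

/-- `𝒯(m,K)`: endomorphisms all of whose periodic points in `K` of minimal period at most `m`
are transverse. -/
def TransSet (n : ℕ) (m : ℕ) (K : Set (Cn n)) : Set (Endo n) :=
  {f | ∀ p ∈ K, IsPer f p → minPer f p ≤ m → (1 : ℂ) ∉ eigs f p}

/-- `ℋ(m,K)`: endomorphisms all of whose periodic points in `K` of minimal period at most `m`
are hyperbolic. -/
def HypSet (n : ℕ) (m : ℕ) (K : Set (Cn n)) : Set (Endo n) :=
  {f | ∀ p ∈ K, IsPer f p → minPer f p ≤ m → ∀ z ∈ eigs f p, ‖z‖ ≠ 1}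

/-- The `m`-th iterate of an endomorphism as an endomorphism. -/
def iterEndo (f : Endo n) (m : ℕ) : Endo n :=
  ⟨⟨(eapp f)^[m], f.1.continuous.iterate m⟩, f.2.iterate m⟩

/-- The set of points with relatively compact forward orbit. -/
def boundedOrb (f : Endo n) : Set (Cn n) :=
  {p | ∃ K : Set (Cn n), IsCompact K ∧ ∀ k : ℕ, (eapp f)^[k] p ∈ K}

/-- An `ε`-chain (pseudo-orbit) of `f` from `x` to `y`. -/
def EpsChain (f : Endo n) (ε : Cn n → ℝ) (x y : Cn n) : Prop :=
  ∃ N : ℕ, 1 ≤ N ∧ ∃ c : ℕ → Cn n, c 0 = x ∧ c N = y ∧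
    ∀ j < N, dist (eapp f (c j)) (c (j + 1)) < ε (eapp f (c j))

/-- `x` and `y` are chain-equivalent for `f`. -/
def ChainEquiv (f : Endo n) (x y : Cn n) : Prop :=
  ∀ ε : Cn n → ℝ, Continuous ε → (∀ z, 0 < ε z) → EpsChain f ε x y ∧ EpsChain f ε y x

/-- `x` is chain-recurrent for `f`. -/
def ChainRec (f : Endo n) (x : Cn n) : Prop :=
  ∀ ε : Cn n → ℝ, Continuous ε → (∀ z, 0 < ε z) → EpsChain f ε x x

/-- Attracting fixed point. -/
def IsAttFix (f : Endo n) (p : Cn n) : Prop :=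
  eapp f p = p ∧ ∀ z ∈ spectrum ℂ (fderiv ℂ (eapp f) p), ‖z‖ < 1

/-- Repelling fixed point. -/
def IsRepFix (f : Endo n) (p : Cn n) : Prop :=
  eapp f p = p ∧ ∀ z ∈ spectrum ℂ (fderiv ℂ (eapp f) p), 1 < ‖z‖

/-- Saddle fixed point. -/
def IsSadFix (f : Endo n) (p : Cn n) : Prop :=
  eapp f p = p ∧ (∀ z ∈ spectrum ℂ (fderiv ℂ (eapp f) p), ‖z‖ ≠ 1) ∧
    (∃ z ∈ spectrum ℂ (fderiv ℂ (eapp f) p), ‖z‖ < 1) ∧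
    (∃ z ∈ spectrum ℂ (fderiv ℂ (eapp f) p), 1 < ‖z‖)

/-- `f` is a local biholomorphism at `p`: `f` agrees near `p` with a homeomorphism onto an
open set whose inverse is holomorphic. -/
def LocalBiholoAt (f : Endo n) (p : Cn n) : Prop :=
  ∃ φ : PartialHomeomorph (Cn n) (Cn n), p ∈ φ.source ∧ Set.EqOn (eapp f) φ φ.source ∧
    DifferentiableOn ℂ φ.symm φ.target

lemma holo_limit {F : ℕ → Cn n → Cn n} (hF : ∀ j, Differentiable ℂ (F j)) {g : Cn n → Cn n}
    {p : Cn n} {r : ℝ} (hr : 0 < r) (h : TendstoUniformlyOn F g atTop (ball p (2 * r))) :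
    DifferentiableOn ℂ g (ball p r) := by
  have hC := h.uniformCauchySeqOn
  have hsub : ∀ x ∈ ball p r, ball x r ⊆ ball p (2 * r) := by
    intro x hx y hy
    rw [mem_ball] at *
    linarith [dist_triangle y x p]
  have hD : UniformCauchySeqOn (fun j => fderiv ℂ (F j)) atTop (ball p r) := by
    rw [Metric.uniformCauchySeqOn_iff] at hC ⊢
    intro ε hε
    obtain ⟨N, hN⟩ := hC (ε * r / 4) (by positivity)
    refine ⟨N, fun a ha b hb x hx => ?_⟩
    have hb1 : ∀ y ∈ ball x r, ‖F a y - F b y‖ < ε * r / 4 := by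
      intro y hy
      rw [← dist_eq_norm]
      exact hN a ha b hb y (hsub x hx hy)
    have h1 : ‖fderiv ℂ (fun y => F a y - F b y) x‖ ≤ (ε * r / 2) / r := by
      apply Complex.norm_fderiv_le_div_of_mapsTo_ball
        ((hF a).fun_sub (hF b)).differentiableOn _ hr
      intro y hy
      rw [mem_closedBall, dist_eq_norm]
      have h2 := hb1 y hy
      have h3 := hb1 x (mem_ball_self hr)
      have := norm_sub_le (F a y - F b y) (F a x - F b x)
      linarith
    rw [fderiv_fun_sub (hF a x) (hF b x)] at h1
    rw [dist_eq_norm]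
    have : (ε * r / 2) / r = ε / 2 := by field_simp
    linarith
  have hlim : ∀ x ∈ ball p r, ∃ L, Tendsto (fun j => fderiv ℂ (F j) x) atTop (𝓝 L) := by
    intro x hx
    exact cauchySeq_tendsto_of_complete (hD.cauchySeq hx)
  choose! G hG using hlim
  have hDG := hD.tendstoUniformlyOn_of_tendsto hG
  intro x hx
  refine (hasFDerivAt_of_tendstoUniformlyOn isOpen_ball hDG
    (fun j y _ => (hF j y).hasFDerivAt) (fun y hy => ?_) hx).differentiableAt.differentiableWithinAt
  exact h.tendsto_at (ball_subset_ball (by linarith) hy)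

lemma montel {F : ℕ → Cn n → Cn n} (hF : ∀ j, Differentiable ℂ (F j))
    {p : Cn n} {r R : ℝ} (hr : 0 < r) (hb : ∀ j, ∀ x ∈ ball p (4 * r), ‖F j x‖ ≤ R) :
    ∃ l : ℕ → ℕ, StrictMono l ∧ ∃ g : Cn n → Cn n, DifferentiableOn ℂ g (ball p r) ∧
      TendstoLocallyUniformlyOn (fun j => F (l j)) g atTop (ball p r) := by
  classical
  have hR : 0 ≤ R := (norm_nonneg _).trans (hb 0 p (mem_ball_self (by linarith)))
  have : CompactSpace (closedBall p (2 * r)) :=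
    isCompact_iff_compactSpace.mp (isCompact_closedBall p (2 * r))
  let φ : ℕ → BoundedContinuousFunction (closedBall p (2 * r)) (Cn n) := fun j =>
    BoundedContinuousFunction.mkOfCompact ⟨fun x => F j x, (hF j).continuous.comp continuous_subtype_val⟩
  have hφ : ∀ j x, φ j x = F j x := fun j x => rfl
  have hlip : ∀ j, ∀ x ∈ closedBall p (2 * r), ∀ y, dist y x < r →
      dist (F j y) (F j x) ≤ (2 * R) / r * dist y x := by
    intro j x hx y hy
    have hsub : ∀ z ∈ ball x r, ‖F j z‖ ≤ R := by
      intro z hz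
      apply hb
      rw [mem_ball] at *
      rw [mem_closedBall] at hx
      linarith [dist_triangle z x p]
    apply Complex.dist_le_div_mul_dist_of_mapsTo_ball (hF j).differentiableOn _ hy
    intro z hz
    rw [mem_closedBall, dist_eq_norm]
    have := norm_sub_le (F j z) (F j x)
    linarith [hsub z hz, hsub x (mem_ball_self hr)]
  have hcomp : IsCompact (closure (Set.range φ)) := by
    apply BoundedContinuousFunction.arzela_ascoli (closedBall 0 R) (isCompact_closedBall _ _)
    · rintro _ x ⟨j, rfl⟩
      rw [mem_closedBall_zero_iff, hφ]
      apply hb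
      have := x.2
      rw [mem_closedBall] at this
      rw [mem_ball]
      linarith
    · intro x
      rw [Metric.equicontinuousAt_iff]
      intro ε hε
      refine ⟨min r (ε * r / (2 * R + 1)), by positivity, ?_⟩
      rintro y hy ⟨_, j, rfl⟩
      have h1 := hlip j x x.2 y (lt_of_lt_of_le hy (min_le_left _ _))
      have h2 : dist (y : Cn n) x < ε * r / (2 * R + 1) := lt_of_lt_of_le hy (min_le_right _ _)
      rw [dist_comm]
      refine lt_of_le_of_lt h1 ?_
      rw [lt_div_iff₀ (by positivity)] at h2
      rw [div_mul_eq_mul_div, div_lt_iff₀ hr]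
      have := dist_nonneg (x := (y : Cn n)) (y := x)
      nlinarith
  obtain ⟨G, -, l, hl, hG⟩ := hcomp.tendsto_subseq (x := φ) (fun j => subset_closure ⟨j, rfl⟩)
  let g : Cn n → Cn n := fun x => if hx : x ∈ closedBall p (2 * r) then G ⟨x, hx⟩ else 0
  have hg : TendstoUniformlyOn (fun j => F (l j)) g atTop (ball p (2 * r)) := by
    rw [BoundedContinuousFunction.tendsto_iff_tendstoUniformly, Metric.tendstoUniformly_iff] at hG
    rw [Metric.tendstoUniformlyOn_iff]
    intro ε hε
    filter_upwards [hG ε hε] with j hj x hx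
    have hx' := ball_subset_closedBall hx
    have := hj ⟨x, hx'⟩
    simp only [g, dif_pos hx']
    exact this
  refine ⟨l, hl, g, holo_limit (fun j => hF (l j)) hr hg, ?_⟩
  exact (hg.mono (ball_subset_ball (by linarith))).tendstoLocallyUniformlyOn

lemma fatou_of_bdd (f : Endo n) {p : Cn n} {U : Set (Cn n)} (hU : U ∈ 𝓝 p) {R : ℝ}
    (hb : ∀ k : ℕ, ∀ x ∈ U, ‖(eapp f)^[k] x‖ ≤ R) : FatouAt f p := by
  obtain ⟨r, hr, hrU⟩ := Metric.mem_nhds_iff.mp hU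
  refine ⟨ball p (r / 4), isOpen_ball, mem_ball_self (by positivity), fun k hk => ?_⟩
  obtain ⟨l, hl, g, hg, h⟩ := montel (F := fun j => (eapp f)^[k j]) (fun j => f.2.iterate _)
    (p := p) (r := r / 4) (R := R) (by positivity)
    (fun j x hx => hb _ x (hrU (by rwa [show 4 * (r / 4) = r by ring] at hx)))
  exact ⟨l, hl, Or.inl ⟨g, hg, h⟩⟩

lemma perturb (f : Endo n) {V : Set (Endo n)} (hV : V ∈ 𝓝 f) :
    ∃ R : ℝ, ∀ x : Cn n, (∃ k, R < ‖(eapp f)^[k] x‖) → ∀ w : Cn n,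
      ∃ g ∈ V, ∃ k, (eapp g)^[k] x = w := by
  classical
  have hV' : ∃ R : ℝ, 0 ≤ R ∧ ∃ ε > 0, ∀ g : Endo n,
      (∀ z ∈ closedBall (0 : Cn n) R, dist (eapp f z) (eapp g z) < ε) → g ∈ V := by
    rw [nhds_subtype_eq_comap, mem_comap] at hV
    obtain ⟨T, hT, hTV⟩ := hV
    rw [(nhds_basis_uniformity
      Metric.uniformity_basis_dist.compactConvergenceUniformity).mem_iff] at hT
    obtain ⟨⟨K, ε⟩, ⟨hK, hε⟩, hsub⟩ := hT
    obtain ⟨R, hR⟩ := hK.isBounded.subset_closedBall 0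
    refine ⟨max R 0, le_max_right _ _, ε, hε, fun g hg => hTV (hsub ?_)⟩
    intro z hz
    have := hg z (closedBall_subset_closedBall (le_max_left _ _) (hR hz))
    rw [dist_comm] at this
    exact this
  obtain ⟨R, hR, ε, hε, hgV⟩ := hV'
  refine ⟨R, fun x hx w => ?_⟩
  let k := Nat.find hx
  have hk : R < ‖(eapp f)^[k] x‖ := Nat.find_spec hx
  have hlt : ∀ i < k, ‖(eapp f)^[i] x‖ ≤ R := fun i hi => not_lt.mp (Nat.find_min hx hi)
  set y := (eapp f)^[k] x with hy
  have hy0 : 0 < ‖y‖ := hR.trans_lt hk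
  let ℓ : Cn n →L[ℂ] ℂ := innerSL ℂ y
  have hℓy : ‖ℓ y‖ = ‖y‖ * ‖y‖ := by
    simp [ℓ, inner_self_eq_norm_sq_to_K, sq]
  have hℓ : ∀ z ∈ closedBall (0 : Cn n) R, ‖ℓ z‖ ≤ ‖y‖ * R := by
    intro z hz
    rw [mem_closedBall_zero_iff] at hz
    calc ‖ℓ z‖ ≤ ‖y‖ * ‖z‖ := norm_inner_le_norm y z
      _ ≤ _ := by gcongr
  have hℓy0 : ℓ y ≠ 0 := by
    rw [← norm_pos_iff, hℓy]; positivity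
  let P : Cn n → ℂ := fun z => ∏ i ∈ Finset.range k,
    (ℓ z - ℓ ((eapp f)^[i] x)) / (ℓ y - ℓ ((eapp f)^[i] x))
  have hPd : Differentiable ℂ P := by
    have hQ : Differentiable ℂ (fun t : ℂ => ∏ i ∈ Finset.range k,
        (t - ℓ ((eapp f)^[i] x)) / (ℓ y - ℓ ((eapp f)^[i] x))) := by
      intro z
      apply DifferentiableAt.fun_finsetProd
      intro i hi
      exact (differentiableAt_id.sub_const _).div_const _
    exact hQ.comp ℓ.differentiable
  have hPy : P y = 1 := by
    apply Finset.prod_eq_one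
    intro i hi
    apply div_self
    intro h0
    have h1 := hℓ ((eapp f)^[i] x)
      (mem_closedBall_zero_iff.mpr (hlt i (Finset.mem_range.mp hi)))
    rw [← sub_eq_zero.mp h0, hℓy] at h1
    nlinarith
  have hPi : ∀ i < k, P ((eapp f)^[i] x) = 0 := by
    intro i hi
    apply Finset.prod_eq_zero (Finset.mem_range.mpr hi)
    simp
  obtain ⟨C, hC⟩ := (isCompact_closedBall (0 : Cn n) R).exists_bound_of_continuousOn
    (f := fun z => P z • (w - eapp f y)) (by
      exact (hPd.continuous.smul continuous_const).continuousOn)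
  have hC0 : 0 ≤ C := (norm_nonneg _).trans (hC 0 (mem_closedBall_self hR))
  have hq : R / ‖y‖ < 1 := (div_lt_one hy0).mpr hk
  obtain ⟨N, hN⟩ := exists_pow_lt_of_lt_one (show 0 < ε / (C + 1) by positivity) hq
  let h : Cn n → Cn n := fun z => (ℓ z / ℓ y) ^ N • (P z • (w - eapp f y))
  have hhd : Differentiable ℂ h := by
    have h1 : Differentiable ℂ (fun z => (ℓ z / ℓ y) ^ N) := by
      simp only [div_eq_mul_inv]
      exact (ℓ.differentiable.mul_const _).fun_pow N
    exact h1.fun_smul (hPd.smul_const _)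
  have hhy : h y = w - eapp f y := by
    simp [h, hPy, div_self hℓy0]
  have hhi : ∀ i < k, h ((eapp f)^[i] x) = 0 := by
    intro i hi
    simp [h, hPi i hi]
  have hgd : Differentiable ℂ (fun z => eapp f z + h z) := f.2.add hhd
  let g : Endo n := ⟨⟨fun z => eapp f z + h z, hgd.continuous⟩, hgd⟩
  have hg : ∀ z, eapp g z = eapp f z + h z := fun z => rfl
  refine ⟨g, hgV g ?_, k + 1, ?_⟩
  · intro z hz
    rw [hg, dist_eq_norm, sub_add_cancel_left, norm_neg]
    simp only [h]
    rw [norm_smul, norm_pow, norm_div, hℓy]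
    have h1 : ‖ℓ z‖ / (‖y‖ * ‖y‖) ≤ R / ‖y‖ := by
      rw [div_le_div_iff₀ (by positivity) hy0]
      nlinarith [hℓ z hz]
    calc (‖ℓ z‖ / (‖y‖ * ‖y‖)) ^ N * ‖P z • (w - eapp f y)‖ ≤ (R / ‖y‖) ^ N * C := by
          gcongr
          exact hC z hz
      _ ≤ ε / (C + 1) * C := by gcongr
      _ < ε := by
          rw [div_mul_eq_mul_div, div_lt_iff₀ (by positivity)]
          nlinarith
  · have hind : ∀ i ≤ k, (eapp g)^[i] x = (eapp f)^[i] x := by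
      intro i
      induction i with
      | zero => intro _; rfl
      | succ i ih =>
        intro hi
        rw [iterate_succ_apply', ih (by omega), hg, hhi i (by omega), add_zero,
          iterate_succ_apply']
    rw [iterate_succ_apply', hind k le_rfl, ← hy, hg, hhy]
    abel

lemma continuous_iter (k : ℕ) (x : Cn n) : Continuous (fun g : Endo n => (eapp g)^[k] x) := by
  induction k with
  | zero => exact continuous_const
  | succ k ih =>
    simp only [iterate_succ_apply']
    have : Continuous (fun g : Endo n => (g : C(Cn n, Cn n)) ((eapp g)^[k] x)) :=
      Continuous.eval continuous_subtype_val ih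
    exact this

lemma generic_a : ∀ᶠ f in residual (Endo n), ∀ p ∈ Julia f, ∀ U : Set (Cn n), IsOpen U → p ∈ U →
    Dense (⋃ k : ℕ, (eapp f)^[k] '' U) := by
  let 𝓑 := TopologicalSpace.countableBasis (Cn n)
  let O : Set (Cn n) → Set (Cn n) → Set (Endo n) := fun B W =>
    {f | ∃ k, ∃ x ∈ B, (eapp f)^[k] x ∈ W}
  have hO : ∀ B W, IsOpen W → IsOpen (O B W) := by
    intro B W hW
    have : O B W = ⋃ k : ℕ, ⋃ x ∈ B, (fun g : Endo n => (eapp g)^[k] x) ⁻¹' W := by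
      ext f; simp [O]
    rw [this]
    exact isOpen_iUnion fun k => isOpen_biUnion fun x _ => hW.preimage (continuous_iter k x)
  have hgen : ∀ᶠ f in residual (Endo n), ∀ B ∈ 𝓑, ∀ W ∈ 𝓑, f ∈ O B W ∪ (closure (O B W))ᶜ := by
    have hc := TopologicalSpace.countable_countableBasis (Cn n)
    rw [eventually_countable_ball hc]
    intro B hB
    rw [eventually_countable_ball hc]
    intro W hW
    have hW' := TopologicalSpace.isOpen_of_mem_countableBasis hW
    refine residual_of_dense_open ((hO B W hW').union isClosed_closure.isOpen_compl) ?_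
    rw [dense_iff_closure_eq, Set.eq_univ_iff_forall]
    intro f
    by_cases hf : f ∈ closure (O B W)
    · exact closure_mono Set.subset_union_left hf
    · exact subset_closure (Or.inr hf)
  filter_upwards [hgen] with f hf p hp U hU hpU
  have hbas := TopologicalSpace.isBasis_countableBasis (Cn n)
  obtain ⟨B, hB, hpB, hBU⟩ := hbas.exists_subset_of_mem_open hpU hU
  rw [hbas.dense_iff]
  intro W hW hWne
  rcases hf B hB W hW with ⟨k, x, hx, hk⟩ | hav
  · exact ⟨_, hk, Set.mem_iUnion.mpr ⟨k, x, hBU hx, rfl⟩⟩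
  · exfalso
    obtain ⟨R, hR⟩ := perturb f (isClosed_closure.isOpen_compl.mem_nhds hav)
    refine hp (fatou_of_bdd f
      ((TopologicalSpace.isOpen_of_mem_countableBasis hB).mem_nhds hpB) (R := R) ?_)
    intro k x hx
    by_contra hcon
    obtain ⟨w, hw⟩ := hWne
    obtain ⟨g, hgV, j, hj⟩ := hR x ⟨k, not_le.mp hcon⟩ w
    exact hgV (subset_closure ⟨j, x, hx, hj ▸ hw⟩)

lemma minPer_pos {f : Endo n} {p : Cn n} (h : IsPer f p) : 0 < minPer f p := by
  obtain ⟨m, hm, h⟩ := h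
  exact IsPeriodicPt.minimalPeriod_pos hm h

lemma iter_minPer (f : Endo n) (p : Cn n) : (eapp f)^[minPer f p] p = p :=
  iterate_minimalPeriod

lemma exists_contr (hn : 1 ≤ n) {f : Endo n} {p : Cn n} (h : IsAttPer f p) :
    ∃ N : ℕ, 0 < N ∧ ∃ c : ℝ, 0 ≤ c ∧ c < 1 ∧ ∃ r > 0, ∀ x ∈ ball p r,
      dist ((eapp f)^[minPer f p * N] x) p ≤ c * dist x p := by
  have : Nonempty (Fin n) := ⟨⟨0, hn⟩⟩
  set m := minPer f p with hm
  set D := fderiv ℂ ((eapp f)^[m]) p with hD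
  have hsr : spectralRadius ℂ D < ((1 : NNReal) : ENNReal) := by
    apply spectrum.spectralRadius_lt_of_forall_lt
    intro z hz
    exact h.2 z hz
  have hG := spectrum.pow_nnnorm_pow_one_div_tendsto_nhds_spectralRadius D
  obtain ⟨N, hN, hN0⟩ := ((hG.eventually_lt_const hsr).and (eventually_gt_atTop 0)).exists
  have hDN : ‖D ^ N‖ < 1 := by
    by_contra hcon
    have h1 : (1 : ENNReal) ≤ (‖D ^ N‖₊ : ENNReal) := by
      exact_mod_cast not_lt.mp hcon
    have h2 : (1 : ENNReal) ≤ (‖D ^ N‖₊ : ENNReal) ^ (1 / N : ℝ) :=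
      ENNReal.one_le_rpow h1 (by positivity)
    exact absurd hN (not_lt.mpr (by simpa using h2))
  obtain ⟨c, hc1, hc2⟩ := exists_between hDN
  refine ⟨N, hN0, c, (norm_nonneg _).trans hc1.le, hc2, ?_⟩
  have hder : HasFDerivAt ((eapp f)^[m * N]) (D ^ N) p := by
    rw [iterate_mul]
    exact HasFDerivAt.iterate ((f.2.iterate m) p).hasFDerivAt (iter_minPer f p) N
  have hfix : (eapp f)^[m * N] p = p := by
    rw [iterate_mul]
    exact iterate_fixed (iter_minPer f p) N
  have hlo := hder.isLittleO.bound (sub_pos.mpr hc1)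
  obtain ⟨r, hr, hball⟩ := Metric.eventually_nhds_iff_ball.mp hlo
  refine ⟨r, hr, fun x hx => ?_⟩
  have h1 := hball x hx
  rw [hfix] at h1
  have h2 := (D ^ N).le_opNorm (x - p)
  have h3 := norm_add_le ((eapp f)^[m * N] x - p - (D ^ N) (x - p)) ((D ^ N) (x - p))
  rw [sub_add_cancel] at h3
  rw [dist_eq_norm, dist_eq_norm]
  linarith

lemma attr_local (hn : 1 ≤ n) {f : Endo n} {p : Cn n} (h : IsAttPer f p) :
    ∃ W : Set (Cn n), IsOpen W ∧ p ∈ W ∧ (∃ R, ∀ k : ℕ, ∀ x ∈ W, ‖(eapp f)^[k] x‖ ≤ R) ∧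
      ∀ x ∈ W, Tendsto (fun k => (eapp f)^[minPer f p * k] x) atTop (𝓝 p) := by
  obtain ⟨N, hN, c, hc0, hc1, r, hr, hcon⟩ := exists_contr hn h
  have hmpos := minPer_pos h.1
  set m := minPer f p with hm
  have hcont : ∀ k, Continuous ((eapp f)^[k]) := fun k => (f.2.iterate k).continuous
  have hit : ∀ x ∈ ball p r, ∀ l : ℕ, dist ((eapp f)^[m * N * l] x) p ≤ c ^ l * dist x p := by
    intro x hx l
    induction l with
    | zero => simp
    | succ l ih =>
      have hmem : (eapp f)^[m * N * l] x ∈ ball p r := by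
        rw [mem_ball] at *
        have : c ^ l ≤ 1 := pow_le_one₀ hc0 hc1.le
        nlinarith [dist_nonneg (x := x) (y := p)]
      rw [mul_add, mul_one, add_comm, iterate_add_apply]
      calc _ ≤ c * dist ((eapp f)^[m * N * l] x) p := hcon _ hmem
        _ ≤ c * (c ^ l * dist x p) := by gcongr
        _ = _ := by ring
  have hmemball : ∀ x ∈ ball p r, ∀ l : ℕ, (eapp f)^[m * N * l] x ∈ ball p r := by
    intro x hx l
    have h1 := hit x hx l
    rw [mem_ball] at *
    have : c ^ l ≤ 1 := pow_le_one₀ hc0 hc1.le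
    nlinarith [dist_nonneg (x := x) (y := p)]
  refine ⟨ball p r, isOpen_ball, mem_ball_self hr, ?_, ?_⟩
  · have hK : IsCompact (⋃ s ∈ Finset.range (m * N), (eapp f)^[s] '' closedBall p r) :=
      (Finset.range (m * N)).isCompact_biUnion
        (fun s _ => (isCompact_closedBall p r).image (hcont s))
    obtain ⟨R, hR⟩ := hK.isBounded.exists_norm_le
    refine ⟨R, fun k x hx => hR _ ?_⟩
    have hq : 0 < m * N := Nat.mul_pos hmpos hN
    simp only [Set.mem_iUnion]
    refine ⟨k % (m * N), Finset.mem_range.mpr (Nat.mod_lt _ hq), (eapp f)^[m * N * (k / (m * N))] x,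
      ball_subset_closedBall (hmemball x hx _), ?_⟩
    rw [← iterate_add_apply, Nat.mod_add_div]
  · intro x hx
    have ht : Tendsto (fun l : ℕ => (eapp f)^[m * N * l] x) atTop (𝓝 p) := by
      rw [tendsto_iff_dist_tendsto_zero]
      refine squeeze_zero (fun _ => dist_nonneg) (hit x hx) ?_
      simpa using (tendsto_pow_atTop_nhds_zero_of_lt_one hc0 hc1).mul_const (dist x p)
    have hfix : ∀ s, (eapp f)^[m * s] p = p := by
      intro s
      rw [iterate_mul]
      exact iterate_fixed (iter_minPer f p) s
    rw [tendsto_def]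
    intro T hT
    have hev : ∀ᶠ l : ℕ in atTop, ∀ s ∈ Finset.range N,
        (eapp f)^[m * s] ((eapp f)^[m * N * l] x) ∈ T := by
      rw [eventually_all_finset]
      intro s _
      have := (((hcont (m * s)).tendsto p).comp ht)
      rw [hfix] at this
      exact this.eventually hT
    have hdiv : Tendsto (fun k : ℕ => k / N) atTop atTop := Nat.tendsto_div_const_atTop hN.ne'
    filter_upwards [hdiv.eventually hev] with k hk
    have h1 := hk (k % N) (Finset.mem_range.mpr (Nat.mod_lt _ hN))
    rw [← iterate_add_apply, mul_assoc, ← mul_add, Nat.mod_add_div] at h1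
    exact h1

lemma basin_backward {f : Endo n} {p : Cn n} {x : Cn n} (hp : IsPer f p) (k : ℕ)
    (hx : (eapp f)^[k] x ∈ basinOf f p) : x ∈ basinOf f p := by
  obtain ⟨a, ⟨i, hi, rfl⟩, ht⟩ := hx
  have hmpos := minPer_pos hp
  set m := minPer f p with hm
  have hfix : ∀ s, (eapp f)^[m * s] p = p := by
    intro s
    rw [iterate_mul]
    exact iterate_fixed (iter_minPer f p) s
  -- push forward by `k * m - k` steps
  obtain ⟨e, he⟩ : ∃ e, e + k = m * k := ⟨m * k - k, by
    have : k ≤ m * k := Nat.le_mul_of_pos_left k hmpos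
    omega⟩
  have hec : Continuous ((eapp f)^[e]) := (f.2.iterate e).continuous
  have h1 := ((hec.tendsto _).comp ht)
  refine ⟨(eapp f)^[(e + i) % m] p, ⟨_, Nat.mod_lt _ hmpos, rfl⟩, ?_⟩
  have h2 : (eapp f)^[(e + i) % m] p = (eapp f)^[e] ((eapp f)^[i] p) := by
    rw [← iterate_add_apply]
    conv_rhs => rw [← Nat.mod_add_div (e + i) m, iterate_add_apply, hfix]
  rw [h2, ← tendsto_add_atTop_iff_nat k]
  refine h1.congr (fun j => ?_)
  simp only [comp_apply]
  rw [← iterate_add_apply, ← iterate_add_apply]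
  rw [mul_add, ← he, show e + m * j + k = m * j + (e + k) by ring]

lemma basin_nhds (hn : 1 ≤ n) {f : Endo n} {p : Cn n} (h : IsAttPer f p) :
    ∃ W : Set (Cn n), IsOpen W ∧ p ∈ W ∧ W ⊆ basinOf f p ∧
      (∃ R, ∀ k : ℕ, ∀ x ∈ W, ‖(eapp f)^[k] x‖ ≤ R) ∧
      (∀ x ∈ basinOf f p, ∃ k, (eapp f)^[k] x ∈ W) ∧
      ∀ x ∈ W, Tendsto (fun k => (eapp f)^[minPer f p * k] x) atTop (𝓝 p) := by
  obtain ⟨W, hWo, hpW, hb, ht⟩ := attr_local hn h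
  have hmpos := minPer_pos h.1
  refine ⟨W, hWo, hpW, fun x hx => ⟨p, ⟨0, hmpos, rfl⟩, ht x hx⟩, hb, ?_, ht⟩
  rintro x ⟨a, ⟨i, hi, rfl⟩, hx⟩
  have h1 := (((f.2.iterate (minPer f p - i)).continuous.tendsto _).comp hx)
  have h2 : (eapp f)^[minPer f p - i] ((eapp f)^[i] p) = p := by
    rw [← iterate_add_apply, Nat.sub_add_cancel hi.le, iter_minPer]
  change Tendsto _ _ (𝓝 ((eapp f)^[minPer f p - i] ((eapp f)^[i] p))) at h1
  rw [h2] at h1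
  obtain ⟨k, hk⟩ := (h1.eventually (hWo.mem_nhds hpW)).exists
  refine ⟨minPer f p - i + minPer f p * k, ?_⟩
  rw [iterate_add_apply]
  exact hk

lemma basin_open (hn : 1 ≤ n) {f : Endo n} {p : Cn n} (h : IsAttPer f p) :
    IsOpen (basinOf f p) := by
  obtain ⟨W, hWo, hpW, hWB, -, hk, -⟩ := basin_nhds hn h
  rw [isOpen_iff_mem_nhds]
  intro x hx
  obtain ⟨k, hk⟩ := hk x hx
  filter_upwards [(hWo.preimage (f.2.iterate k).continuous).mem_nhds hk] with y hy
  exact basin_backward h.1 k (hWB hy)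

lemma basin_fatou (hn : 1 ≤ n) {f : Endo n} {p : Cn n} (h : IsAttPer f p) {x : Cn n}
    (hx : x ∈ basinOf f p) : FatouAt f x := by
  obtain ⟨W, hWo, hpW, -, ⟨R, hR⟩, hk, -⟩ := basin_nhds hn h
  obtain ⟨k, hk⟩ := hk x hx
  have hcont : ∀ k, Continuous ((eapp f)^[k]) := fun k => (f.2.iterate k).continuous
  have hK : IsCompact (⋃ s ∈ Finset.range k, (eapp f)^[s] '' closedBall x 1) :=
    (Finset.range k).isCompact_biUnion
      (fun s _ => (isCompact_closedBall x 1).image (hcont s))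
  obtain ⟨R', hR'⟩ := hK.isBounded.exists_norm_le
  refine fatou_of_bdd f (U := (eapp f)^[k] ⁻¹' W ∩ closedBall x 1) (R := max R R')
    (inter_mem ((hWo.preimage (hcont k)).mem_nhds hk) (closedBall_mem_nhds x one_pos)) ?_
  rintro j y ⟨hy1, hy2⟩
  rcases lt_or_ge j k with hj | hj
  · refine (hR' _ ?_).trans (le_max_right _ _)
    simp only [Set.mem_iUnion]
    exact ⟨j, Finset.mem_range.mpr hj, y, hy2, rfl⟩
  · refine le_trans ?_ (le_max_left _ _)
    obtain ⟨e, rfl⟩ := Nat.exists_eq_add_of_le hj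
    rw [add_comm, iterate_add_apply]
    exact hR e _ hy1

lemma frontier_julia (hn : 1 ≤ n) {f : Endo n} {p : Cn n} (h : IsAttPer f p) {x : Cn n}
    (hx : x ∈ closure (basinOf f p)) (hF : FatouAt f x) : x ∈ basinOf f p := by
  obtain ⟨U, hU, hxU, hnorm⟩ := hF
  have hmpos := minPer_pos h.1
  have hBo := basin_open hn h
  obtain ⟨W, hWo, hpW, hWB, ⟨R, hR⟩, hkW, htW⟩ := basin_nhds hn h
  obtain ⟨r, hr, hrU⟩ := Metric.isOpen_iff.mp hU x hxU
  obtain ⟨x0, hx0r, hx0B⟩ := mem_closure_iff.mp hx (ball x r) isOpen_ball (mem_ball_self hr)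
  obtain ⟨k0, hk0⟩ := hkW x0 hx0B
  have hcont : ∀ k, Continuous ((eapp f)^[k]) := fun k => (f.2.iterate k).continuous
  have hmono : StrictMono (fun j => minPer f p * j + k0) := by
    intro a b hab
    have := Nat.mul_lt_mul_of_pos_left hab hmpos
    simpa using this
  obtain ⟨l, hl, hcase⟩ := hnorm _ hmono
  have hW' : ∀ y ∈ (eapp f)^[k0] ⁻¹' W,
      Tendsto (fun j => (eapp f)^[minPer f p * l j + k0] y) atTop (𝓝 p) := by
    intro y hy
    have := (htW _ hy).comp hl.tendsto_atTop
    refine this.congr (fun j => ?_)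
    simp only [comp_apply]
    rw [← iterate_add_apply]
  rcases hcase with ⟨g, hgd, hg⟩ | hdiv
  · have hgp : ∀ y ∈ (eapp f)^[k0] ⁻¹' W ∩ ball x r, g y = p := by
      rintro y ⟨hy, hyr⟩
      exact tendsto_nhds_unique (hg.tendsto_at (hrU hyr)) (hW' y hy)
    -- restrict to the complex line through `x0` and `x`
    let L : ℂ → Cn n := fun t => x0 + t • (x - x0)
    have hLd : Differentiable ℂ L :=
      (differentiable_id.smul_const (x - x0)).const_add x0
    have hLc : Convex ℝ (L ⁻¹' ball x r) := by
      intro s hs t ht a b ha hb hab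
      have : L (a • s + b • t) = a • L s + b • L t := by
        simp only [L]
        rw [smul_add, smul_add, add_add_add_comm, ← add_smul, hab, one_smul, add_smul,
          smul_assoc, smul_assoc]
      rw [Set.mem_preimage, this]
      exact convex_ball x r hs ht ha hb hab
    have hLo : IsOpen (L ⁻¹' ball x r) := isOpen_ball.preimage hLd.continuous
    have hgL : DifferentiableOn ℂ (g ∘ L) (L ⁻¹' ball x r) :=
      (hgd.mono hrU).comp hLd.differentiableOn (fun t ht => ht)
    have hL0 : L 0 = x0 := by simp [L]
    have hL1 : L 1 = x := by simp [L]
    have heq : Set.EqOn (g ∘ L) (fun _ => p) (L ⁻¹' ball x r) := by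
      refine (hgL.analyticOnNhd hLo).eqOn_of_preconnected_of_eventuallyEq
        analyticOnNhd_const hLc.isPreconnected (z₀ := 0) ?_ ?_
      · rw [Set.mem_preimage, hL0]; exact hx0r
      · have hopen : IsOpen (L ⁻¹' ((eapp f)^[k0] ⁻¹' W ∩ ball x r)) :=
          ((hWo.preimage (hcont k0)).inter isOpen_ball).preimage hLd.continuous
        filter_upwards [hopen.mem_nhds (show (0 : ℂ) ∈ _ by
          rw [Set.mem_preimage, hL0]; exact ⟨hk0, hx0r⟩)] with t ht
        exact hgp _ ht
    have hgx : g x = p := by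
      have := heq (show (1 : ℂ) ∈ L ⁻¹' ball x r by
        rw [Set.mem_preimage, hL1]; exact mem_ball_self hr)
      simpa [hL1] using this
    have ht := hg.tendsto_at hxU
    rw [hgx] at ht
    obtain ⟨j, hj⟩ := (ht.eventually (hWo.mem_nhds hpW)).exists
    exact basin_backward h.1 _ (hWB hj)
  · exfalso
    have h1 := hdiv {x0} (Set.singleton_subset_iff.mpr (hrU hx0r)) isCompact_singleton
      (closedBall 0 R) (isCompact_closedBall 0 R)
    obtain ⟨j, hj⟩ := h1.exists
    refine Set.disjoint_left.mp hj (Set.mem_image_of_mem _ (Set.mem_singleton x0)) ?_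
    rw [mem_closedBall_zero_iff]
    beta_reduce
    rw [iterate_add_apply]
    exact hR _ _ hk0

/-- For a generic endomorphism `f` of `ℂⁿ`: forward images of any neighbourhood of a point of
`J_f` are jointly dense in `ℂⁿ`, and `J_f` is the boundary of every basin of attraction. -/
theorem stmt_16 (n : ℕ) (hn : 1 ≤ n) :
    {f : Endo n | (∀ p ∈ Julia f, ∀ U : Set (Cn n), IsOpen U → p ∈ U →
        Dense (⋃ k : ℕ, (eapp f)^[k] '' U)) ∧
      (∀ p : Cn n, IsAttPer f p → Julia f = frontier (basinOf f p))} ∈ residual (Endo n) := by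
  filter_upwards [generic_a (n := n)] with f hf
  refine ⟨hf, fun p hp => ?_⟩
  have hBo := basin_open hn hp
  rw [hBo.frontier_eq]
  ext x
  constructor
  · intro hx
    refine ⟨?_, fun hxB => hx (basin_fatou hn hp hxB)⟩
    rw [_root_.mem_closure_iff]
    intro U hU hxU
    obtain ⟨W, hWo, hpW, hWB, -⟩ := basin_nhds hn hp
    obtain ⟨y, hyW, hy⟩ := (hf x hx U hU hxU).inter_open_nonempty W hWo ⟨p, hpW⟩
    obtain ⟨k, z, hz, rfl⟩ := Set.mem_iUnion.mp hy
    exact ⟨z, hz, basin_backward hp.1 k (hWB hyW)⟩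
  · rintro ⟨hx1, hx2⟩ hF
    exact hx2 (frontier_julia hn hp hx1 hF)
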